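/- arXiv:1909.06646 — 4 statements merged into one kernel-verified Lean document; each statement's English description precedes it below -/
import Mathlib

section
/- Let (X,x) be a pointed geodesic metric space, Y a cobounded subset of X, and T an (ε,k)-tight geodesic combing of (X,x). Define d_x : Y → ℝ≥0 by d_x(y) = d(x,y). Then D(s,K) = (6/ε)s + 6K is a (k−1)-dimensional control function for the map d_x; in particular asdimAN(d_x) ≤ k − 1. -/
open Metric Set

/-- A family `𝒱` of subsets is uniformly bounded by `D`: every member has diameter `≤ D`. -/
def UnifBounded {X : Type*} [MetricSpace X] (𝒱 : Set (Set X)) (D : ℝ) : Prop :=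
  ∀ A ∈ 𝒱, ∀ p ∈ A, ∀ q ∈ A, dist p q ≤ D

/-- The family `𝒱` has `r`-multiplicity at most `m`: every open ball of radius `r`
meets at most `m` members of `𝒱`. -/
def MultAtMost {X : Type*} [MetricSpace X] (𝒱 : Set (Set X)) (r : ℝ) (m : ℕ) : Prop :=
  ∀ x : X, {A | A ∈ 𝒱 ∧ (A ∩ Metric.ball x r).Nonempty}.Finite ∧
    {A | A ∈ 𝒱 ∧ (A ∩ Metric.ball x r).Nonempty}.ncard ≤ m

/-- `D` is an `n`-dimensional control function for `X`: for every `r > 0` there is a cover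
of `X` uniformly bounded by `D r` whose `r`-multiplicity is at most `n + 1`. -/
def IsControlFunction (X : Type*) [MetricSpace X] (n : ℕ) (D : ℝ → ℝ) : Prop :=
  ∀ r > 0, ∃ 𝒱 : Set (Set X), ⋃₀ 𝒱 = Set.univ ∧ UnifBounded 𝒱 (D r) ∧ MultAtMost 𝒱 r (n + 1)

/-- The asymptotic Assouad–Nagata dimension of `X` is at most `n`: some linear function
`D r = a * r + b` with `a, b > 0` is an `n`-dimensional control function for `X`. -/
def ASDimANLe (X : Type*) [MetricSpace X] (n : ℕ) : Prop :=
  ∃ a > (0 : ℝ), ∃ b > (0 : ℝ), IsControlFunction X n (fun r => a * r + b)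

/-- `X` is a geodesic metric space: any two points are joined by an isometrically
parametrized geodesic segment. -/
def IsGeodesicSpace (X : Type*) [MetricSpace X] : Prop :=
  ∀ a b : X, ∃ γ : ℝ → X, γ 0 = a ∧ γ (dist a b) = b ∧
    ∀ s ∈ Set.Icc (0 : ℝ) (dist a b), ∀ t ∈ Set.Icc (0 : ℝ) (dist a b),
      dist (γ s) (γ t) = |s - t|

/-- A geodesic combing of the pointed metric space `(X, x)`: a cobounded set `Y ⊆ X`
together with, for each `y ∈ Y`, a geodesic `γ y` from `x` to `y`. -/
structure GeodesicCombing (X : Type*) [MetricSpace X] (x : X) where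
  Y : Set X
  cobounded : ∃ c > (0 : ℝ), ∀ z : X, Metric.infDist z Y ≤ c
  γ : X → ℝ → X
  start : ∀ y ∈ Y, γ y 0 = x
  finish : ∀ y ∈ Y, γ y (dist x y) = y
  geod : ∀ y ∈ Y, ∀ s ∈ Set.Icc (0 : ℝ) (dist x y), ∀ t ∈ Set.Icc (0 : ℝ) (dist x y),
    dist (γ y s) (γ y t) = |s - t|

/-- The image `T_y` of the combing geodesic from `x` to `y`, as a subset of `X`. -/
def GeodesicCombing.seg {X : Type*} [MetricSpace X] {x : X} (C : GeodesicCombing X x)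
    (y : X) : Set X :=
  C.γ y '' Set.Icc 0 (dist x y)

/-- `T(y, s)`: the union of the combing geodesics `T_{y'}` over `y' ∈ Y` with `d(y, y') < s`. -/
def GeodesicCombing.tube {X : Type*} [MetricSpace X] {x : X} (C : GeodesicCombing X x)
    (y : X) (s : ℝ) : Set X :=
  ⋃ y' ∈ C.Y ∩ Metric.ball y s, C.seg y'

/-- The combing is `(ε, k)`-tight: for all `r > 0`, `y ∈ Y`, and `t ≤ d(x, y) - r`,
the set `T(y, ε r) ∩ S(t)` has at most `k` elements. -/
def GeodesicCombing.Tight {X : Type*} [MetricSpace X] {x : X} (C : GeodesicCombing X x)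
    (ε : ℝ) (k : ℕ) : Prop :=
  ∀ r > (0 : ℝ), ∀ y ∈ C.Y, ∀ t : ℝ, t ≤ dist x y - r →
    (C.tube y (ε * r) ∩ Metric.sphere x t).Finite ∧
    (C.tube y (ε * r) ∩ Metric.sphere x t).ncard ≤ k

/-- `D` is an `n`-dimensional control function for the map `f : X → Z`: for all `s, K > 0`
and every `A ⊆ X` with `f '' A` of diameter at most `K`, there is a cover of `A` with
`s`-multiplicity at most `n + 1` which is uniformly bounded by `D s K`. -/
def IsMapControlFunction {X Z : Type*} [MetricSpace X] [MetricSpace Z] (f : X → Z) (n : ℕ)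
    (D : ℝ → ℝ → ℝ) : Prop :=
  ∀ s > (0 : ℝ), ∀ K > (0 : ℝ), ∀ A : Set X, (∀ p ∈ A, ∀ q ∈ A, dist (f p) (f q) ≤ K) →
    ∃ 𝒱 : Set (Set X), A ⊆ ⋃₀ 𝒱 ∧
      (∀ B ∈ 𝒱, ∀ p ∈ B, ∀ q ∈ B, dist p q ≤ D s K) ∧
      ∀ x : X, {B | B ∈ 𝒱 ∧ (B ∩ Metric.ball x s).Nonempty}.Finite ∧
        {B | B ∈ 𝒱 ∧ (B ∩ Metric.ball x s).Nonempty}.ncard ≤ n + 1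

/-- Enlarging the bound of a control function gives a control function. -/
theorem IsMapControlFunction.mono {X Z : Type*} [MetricSpace X] [MetricSpace Z] {f : X → Z}
    {n : ℕ} {D D' : ℝ → ℝ → ℝ} (h : IsMapControlFunction f n D)
    (hD : ∀ s > 0, ∀ K > 0, D s K ≤ D' s K) : IsMapControlFunction f n D' := by
  intro s hs K hK A hA
  obtain ⟨𝒱, hcov, hbdd, hmult⟩ := h s hs K hK A hA
  exact ⟨𝒱, hcov, fun B hB p hp q hq => (hbdd B hB p hp q hq).trans (hD s hs K hK), hmult⟩

namespace GeodesicCombing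

variable {X : Type*} [MetricSpace X] {x : X} (C : GeodesicCombing X x)

theorem dist_base {y : X} (hy : y ∈ C.Y) {t : ℝ} (ht : t ∈ Set.Icc 0 (dist x y)) :
    dist x (C.γ y t) = t := by
  have h := C.geod y hy 0 ⟨le_rfl, dist_nonneg⟩ t ht
  rwa [C.start y hy, zero_sub, abs_neg, abs_of_nonneg ht.1] at h

theorem dist_endpoint {y : X} (hy : y ∈ C.Y) {t : ℝ} (ht : t ∈ Set.Icc 0 (dist x y)) :
    dist (C.γ y t) y = dist x y - t := by
  have h := C.geod y hy t ht (dist x y) ⟨dist_nonneg, le_rfl⟩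
  rwa [C.finish y hy, abs_sub_comm, abs_of_nonneg (sub_nonneg.2 ht.2)] at h

theorem mem_tube_inter_sphere {y y' : X} {s t : ℝ} (hy' : y' ∈ C.Y) (hd : dist y' y < s)
    (ht : t ∈ Set.Icc 0 (dist x y')) : C.γ y' t ∈ C.tube y s ∩ Metric.sphere x t := by
  refine ⟨Set.mem_iUnion₂.2 ⟨y', ⟨hy', Metric.mem_ball.2 hd⟩, t, ht, rfl⟩, ?_⟩
  rw [Metric.mem_sphere, dist_comm, C.dist_base hy' ht]

/-- Points of `A` sorted by where their combing geodesics cross the sphere of radius `t`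
form a cover of small multiplicity. -/
theorem Tight.exists_cover {ε : ℝ} {k : ℕ} (h : C.Tight ε k) (hε : 0 < ε) {s K d : ℝ}
    (hs : 0 < s) (hd : 2 * s / ε ≤ d) {A : Set C.Y}
    (hA : ∀ p ∈ A, dist x (p : X) ∈ Set.Icc d (d + K)) :
    ∃ 𝒱 : Set (Set C.Y), A ⊆ ⋃₀ 𝒱 ∧
      (∀ B ∈ 𝒱, ∀ p ∈ B, ∀ q ∈ B, dist p q ≤ 2 * (K + 2 * s / ε)) ∧
      ∀ c : C.Y, {B | B ∈ 𝒱 ∧ (B ∩ Metric.ball c s).Nonempty}.Finite ∧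
        {B | B ∈ 𝒱 ∧ (B ∩ Metric.ball c s).Nonempty}.ncard ≤ k := by
  set r := 2 * s / ε with hr
  have hr0 : 0 < r := by positivity
  have hεr : ε * r = 2 * s := by rw [hr]; field_simp
  have ht : ∀ p ∈ A, d - r ∈ Set.Icc 0 (dist x (p : X)) := fun p hp =>
    ⟨sub_nonneg.2 hd, by linarith [(hA p hp).1]⟩
  let V : X → Set C.Y := fun z => {p | p ∈ A ∧ C.γ p (d - r) = z}
  refine ⟨Set.range V, fun p hp => ⟨V (C.γ p (d - r)), ⟨_, rfl⟩, hp, rfl⟩, ?_, ?_⟩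
  · rintro _ ⟨z, rfl⟩ p ⟨hp, hpz⟩ q ⟨hq, hqz⟩
    have h1 := C.dist_endpoint p.2 (ht p hp)
    have h2 := C.dist_endpoint q.2 (ht q hq)
    rw [hpz] at h1
    rw [hqz] at h2
    have := dist_triangle_left (p : X) q z
    rw [Subtype.dist_eq]
    linarith [(hA p hp).2, (hA q hq).2]
  · intro c
    rcases Set.eq_empty_or_nonempty
      {B | B ∈ Set.range V ∧ (B ∩ Metric.ball c s).Nonempty} with he | ⟨B, ⟨z, rfl⟩, y, hy, hyc⟩
    · rw [he]; simp
    · obtain ⟨hfin, hcard⟩ := h r hr0 y y.2 (d - r) (by linarith [(hA y hy.1).1])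
      have hsub : {B | B ∈ Set.range V ∧ (B ∩ Metric.ball c s).Nonempty} ⊆
          V '' (C.tube y (ε * r) ∩ Metric.sphere x (d - r)) := by
        rintro _ ⟨⟨w, rfl⟩, p, ⟨hp, rfl⟩, hpc⟩
        refine ⟨_, C.mem_tube_inter_sphere p.2 ?_ (ht p hp), rfl⟩
        rw [Metric.mem_ball] at hpc hyc
        rw [hεr, ← Subtype.dist_eq]
        linarith [dist_triangle_right p y c]
      exact ⟨(hfin.image V).subset hsub,
        (Set.ncard_le_ncard hsub (hfin.image V)).trans ((Set.ncard_image_le hfin).trans hcard)⟩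

theorem Tight.isMapControlFunction {ε : ℝ} {k : ℕ} (h : C.Tight ε k) (hε : 0 < ε) :
    IsMapControlFunction (fun y : C.Y => nndist x (y : X)) (k - 1)
      (fun s K => 2 * (K + 2 * s / ε)) := by
  intro s hs K hK A hA
  obtain rfl | hne := A.eq_empty_or_nonempty
  · exact ⟨∅, by simp⟩
  have hA' : ∀ p ∈ A, ∀ q ∈ A, dist x (p : X) ≤ dist x (q : X) + K := fun p hp q hq => by
    have := hA p hp q hq
    rw [NNReal.dist_eq, coe_nndist, coe_nndist] at this
    linarith [le_abs_self (dist x (p : X) - dist x (q : X))]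
  set f : C.Y → ℝ := fun p => dist x (p : X)
  have hIcc : ∀ p ∈ A, dist x (p : X) ∈ Set.Icc (sInf (f '' A)) (sInf (f '' A) + K) := by
    intro p hp
    refine ⟨csInf_le ⟨0, by rintro _ ⟨q, -, rfl⟩; exact dist_nonneg⟩ ⟨p, hp, rfl⟩, ?_⟩
    rw [← sub_le_iff_le_add]
    refine le_csInf (hne.image f) ?_
    rintro _ ⟨q, hq, rfl⟩
    exact sub_le_iff_le_add.2 (hA' p hp q hq)
  rcases le_or_gt (2 * s / ε) (sInf (f '' A)) with hd | hd
  · obtain ⟨𝒱, hcov, hbdd, hmult⟩ := Tight.exists_cover C h hε hs hd hIcc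
    exact ⟨𝒱, hcov, hbdd, fun c => ⟨(hmult c).1, (hmult c).2.trans (by omega)⟩⟩
  · refine ⟨{A}, by simp, ?_, fun c => ?_⟩
    · rintro _ rfl p hp q hq
      have := dist_triangle_left (p : X) q x
      rw [Subtype.dist_eq]
      linarith [(hIcc p hp).2, (hIcc q hq).2]
    · have hsub : {B | B ∈ ({A} : Set (Set C.Y)) ∧ (B ∩ Metric.ball c s).Nonempty} ⊆ {A} :=
        fun _ hB => hB.1
      refine ⟨(Set.finite_singleton A).subset hsub, ?_⟩
      have := Set.ncard_le_ncard hsub (Set.finite_singleton A)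
      rw [Set.ncard_singleton] at this
      omega

end GeodesicCombing

/-- Let `T` be an `(ε, k)`-tight geodesic combing of a pointed geodesic metric space
`(X, x)` with cobounded index set `Y`, and let `d_x : Y → ℝ≥0` be `d_x y = d(x, y)`.
Then `D(s, K) = (6/ε) s + 6 K` is a `(k - 1)`-dimensional control function for the map
`d_x`; in particular `asdimAN(d_x) ≤ k - 1`. -/
theorem dist_map_control_of_tight_combing {X : Type*} [MetricSpace X] (x : X)
    (hX : IsGeodesicSpace X) (ε : ℝ) (hε : 0 < ε) (k : ℕ)
    (C : GeodesicCombing X x) (ht : C.Tight ε k) :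
    IsMapControlFunction (fun y : ↥C.Y => nndist x (y : X)) (k - 1)
      (fun s K => (6 / ε) * s + 6 * K) ∧
    ∃ a > (0 : ℝ), ∃ b > (0 : ℝ), ∃ c > (0 : ℝ),
      IsMapControlFunction (fun y : ↥C.Y => nndist x (y : X)) (k - 1)
        (fun s K => a * s + b * K + c) := by
  have hbound : ∀ s > 0, ∀ K > 0, 2 * (K + 2 * s / ε) ≤ 6 / ε * s + 6 * K := by
    intro s hs K hK
    have h1 : 0 < s / ε := by positivity
    have h2 : 6 / ε * s = 6 * (s / ε) := by ring
    have h3 : 2 * s / ε = 2 * (s / ε) := by ring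
    linarith
  have h := (GeodesicCombing.Tight.isMapControlFunction C ht hε).mono hbound
  exact ⟨h, 6 / ε, by positivity, 6, by norm_num, 1, one_pos, h.mono fun s _ K _ => by linarith⟩
end

section
/- Asymptotic Assouad-Nagata dimension is invariant under quasi-isometry: if X and Y are metric spaces and there exists a quasi-isometry f: X → Y, then asdimAN(X) = asdimAN(Y). -/
open Metric Set

/-- The asymptotic dimension of `X` is at most `n`: some `n`-dimensional control function
for `X` exists. -/
def ASDimLe (X : Type*) [MetricSpace X] (n : ℕ) : Prop :=
  ∃ D : ℝ → ℝ, IsControlFunction X n D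

/-- The asymptotic dimension of `X`, as an element of `ℕ∞`: the least `n` admitting an
`n`-dimensional control function, or `∞` if none exists. -/
noncomputable def asdim (X : Type*) [MetricSpace X] : ℕ∞ :=
  sInf {c : ℕ∞ | ∃ n : ℕ, c = (n : ℕ∞) ∧ ASDimLe X n}

/-- The asymptotic Assouad–Nagata dimension of `X`, as an element of `ℕ∞`: the least `n`
admitting an `n`-dimensional control function of the form `D r = a * r + b` with
`a, b > 0`, or `∞` if none exists. -/
noncomputable def asdimAN (X : Type*) [MetricSpace X] : ℕ∞ :=
  sInf {c : ℕ∞ | ∃ n : ℕ, c = (n : ℕ∞) ∧ ASDimANLe X n}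

/-- `f : X → Y` is a quasi-isometry: for some `L ≥ 1` and `C ≥ 0`,
`(1/L) d(x, x') - C ≤ d(f x, f x') ≤ L d(x, x') + C` for all `x, x'`, and every point of
`Y` is within distance `C` of the image of `f`. -/
def IsQuasiIsometry {X Y : Type*} [MetricSpace X] [MetricSpace Y] (f : X → Y) : Prop :=
  ∃ L : ℝ, 1 ≤ L ∧ ∃ C : ℝ, 0 ≤ C ∧
    (∀ a b : X, (1 / L) * dist a b - C ≤ dist (f a) (f b) ∧
      dist (f a) (f b) ≤ L * dist a b + C) ∧
    ∀ z : Y, ∃ a : X, dist z (f a) ≤ C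

/-- A map with linear upper and lower distance bounds pulls back linear control functions. -/
lemma ASDimANLe.of_linear_bounds {X Y : Type*} [MetricSpace X] [MetricSpace Y] {n : ℕ}
    {f : X → Y} {L C : ℝ} (hL : 0 < L) (hC : 0 ≤ C)
    (hlo : ∀ a b, dist a b ≤ L * dist (f a) (f b) + C)
    (hup : ∀ a b, dist (f a) (f b) ≤ L * dist a b + C) (hY : ASDimANLe Y n) :
    ASDimANLe X n := by
  obtain ⟨a, ha, b, hb, h⟩ := hY
  refine ⟨L * a * L, by positivity, L * (a * C + b) + C, by positivity, fun r hr => ?_⟩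
  obtain ⟨𝒱, hcov, hbd, hm⟩ := h (L * r + C) (by positivity)
  refine ⟨Set.preimage f '' 𝒱, ?_, ?_, fun x => ?_⟩
  · refine Set.eq_univ_of_forall fun x => ?_
    obtain ⟨A, hA, hx⟩ := Set.mem_sUnion.1 (hcov ▸ Set.mem_univ (f x))
    exact ⟨f ⁻¹' A, ⟨A, hA, rfl⟩, hx⟩
  · rintro _ ⟨A, hA, rfl⟩ p hp q hq
    calc dist p q ≤ L * dist (f p) (f q) + C := hlo p q
      _ ≤ L * (a * (L * r + C) + b) + C := by
        gcongr
        exact hbd A hA _ hp _ hq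
      _ = L * a * L * r + (L * (a * C + b) + C) := by ring
  · obtain ⟨hfin, hcard⟩ := hm (f x)
    have hsub : {B | B ∈ Set.preimage f '' 𝒱 ∧ (B ∩ Metric.ball x r).Nonempty} ⊆
        Set.preimage f ''
          {A | A ∈ 𝒱 ∧ (A ∩ Metric.ball (f x) (L * r + C)).Nonempty} := by
      rintro _ ⟨⟨A, hA, rfl⟩, y, hyA, hy⟩
      refine ⟨A, ⟨hA, f y, hyA, ?_⟩, rfl⟩
      calc dist (f y) (f x) ≤ L * dist y x + C := hup y x
        _ < L * r + C := by
          gcongr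
          exact hy
    exact ⟨(hfin.image _).subset hsub, (Set.ncard_le_ncard hsub (hfin.image _)).trans
      ((Set.ncard_image_le hfin).trans hcard)⟩

lemma IsQuasiIsometry.asdimANLe_iff {X Y : Type*} [MetricSpace X] [MetricSpace Y]
    {f : X → Y} (hf : IsQuasiIsometry f) (n : ℕ) : ASDimANLe X n ↔ ASDimANLe Y n := by
  obtain ⟨L, hL, C, hC, hd, hs⟩ := hf
  have hL0 : 0 < L := by linarith
  have hLC : C ≤ L * C := le_mul_of_one_le_left hC hL
  have hlo : ∀ a b, dist a b ≤ L * dist (f a) (f b) + L * C := fun a b => by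
    have h := mul_le_mul_of_nonneg_left (hd a b).1 hL0.le
    have e : L * (1 / L * dist a b - C) = dist a b - L * C := by field_simp
    linarith
  choose g hg using hs
  constructor
  · refine ASDimANLe.of_linear_bounds (f := g) (C := 3 * (L * C)) hL0 (by positivity)
      (fun y z => ?_) fun y z => ?_
    · have h := dist_triangle4 y (f (g y)) (f (g z)) z
      rw [dist_comm (f (g z)) z] at h
      linarith [hg y, hg z, (hd (g y) (g z)).2]
    · have h := dist_triangle4 (f (g y)) y z (f (g z))
      rw [dist_comm (f (g y)) y] at h
      have h' : dist (f (g y)) (f (g z)) ≤ dist y z + 2 * C := by linarith [hg y, hg z]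
      linarith [hlo (g y) (g z), mul_le_mul_of_nonneg_left h' hL0.le]
  · exact ASDimANLe.of_linear_bounds hL0 (by positivity) hlo
      fun a b => (hd a b).2.trans (by gcongr)

/-- Asymptotic Assouad–Nagata dimension is invariant under quasi-isometry: if there is a
quasi-isometry `f : X → Y` between metric spaces, then `asdimAN X = asdimAN Y`. -/
theorem asdimAN_eq_of_quasiIsometry {X Y : Type*} [MetricSpace X] [MetricSpace Y]
    (h : ∃ f : X → Y, IsQuasiIsometry f) :
    asdimAN X = asdimAN Y := by
  obtain ⟨f, hf⟩ := h
  simp only [asdimAN, hf.asdimANLe_iff]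
end

section
/- Asymptotic dimension is invariant under quasi-isometry: if X and Y are metric spaces and there exists a quasi-isometry f: X → Y, then asdim(X) = asdim(Y). -/
open Metric Set

/-- Asymptotic dimension bounds pull back along maps that distort distances at most affinely. -/
theorem ASDimLe.of_affine_distortion {X Y : Type*} [MetricSpace X] [MetricSpace Y] {f : X → Y}
    {K M : ℝ} (hK : 0 < K) (hM : 0 ≤ M)
    (hlower : ∀ a b, dist a b ≤ K * dist (f a) (f b) + M)
    (hupper : ∀ a b, dist (f a) (f b) ≤ K * dist a b + M)
    {n : ℕ} (h : ASDimLe Y n) : ASDimLe X n := by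
  obtain ⟨D, hD⟩ := h
  refine ⟨fun r => K * D (K * r + M) + M, fun r hr => ?_⟩
  obtain ⟨𝒱, hcover, hbounded, hmult⟩ := hD (K * r + M) (by positivity)
  refine ⟨(f ⁻¹' ·) '' 𝒱, ?_, ?_, fun x => ?_⟩
  · refine eq_univ_of_forall fun x => ?_
    obtain ⟨A, hA, hx⟩ := mem_sUnion.1 (hcover ▸ mem_univ (f x))
    exact ⟨f ⁻¹' A, mem_image_of_mem _ hA, hx⟩
  · rintro _ ⟨A, hA, rfl⟩ p hp q hq
    have hpq := mul_le_mul_of_nonneg_left (hbounded A hA (f p) hp (f q) hq) hK.le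
    linarith [hlower p q]
  · obtain ⟨hfin, hcard⟩ := hmult (f x)
    have hsub : {B | B ∈ (f ⁻¹' ·) '' 𝒱 ∧ (B ∩ ball x r).Nonempty} ⊆
        (f ⁻¹' ·) '' {A | A ∈ 𝒱 ∧ (A ∩ ball (f x) (K * r + M)).Nonempty} := by
      rintro _ ⟨⟨A, hA, rfl⟩, y, hyA, hy⟩
      refine ⟨A, ⟨hA, f y, hyA, ?_⟩, rfl⟩
      have hyx := mul_lt_mul_of_pos_left (mem_ball.1 hy) hK
      exact mem_ball.2 (by linarith [hupper y x])
    exact ⟨(hfin.image _).subset hsub,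
      (ncard_le_ncard hsub (hfin.image _)).trans ((ncard_image_le hfin).trans hcard)⟩

/-- A quasi-isometry preserves upper bounds on asymptotic dimension in both directions. -/
theorem IsQuasiIsometry.asdimLe_iff {X Y : Type*} [MetricSpace X] [MetricSpace Y] {f : X → Y}
    (hf : IsQuasiIsometry f) (n : ℕ) : ASDimLe X n ↔ ASDimLe Y n := by
  obtain ⟨L, hL, C, hC, hdist, hdense⟩ := hf
  have hL0 : 0 < L := by linarith
  have hCL : C ≤ L * C := le_mul_of_one_le_left hC hL
  have hlower (a b : X) : dist a b ≤ L * dist (f a) (f b) + L * C := by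
    have hab := mul_le_mul_of_nonneg_left (hdist a b).1 hL0.le
    rw [mul_sub, ← mul_assoc, mul_one_div_cancel hL0.ne', one_mul] at hab
    linarith
  choose g hg using hdense
  constructor
  · refine ASDimLe.of_affine_distortion (f := g) (M := 3 * (L * C)) hL0 (by positivity)
      (fun z w => ?_) (fun z w => ?_)
    · have hzw := dist_triangle4 z (f (g z)) (f (g w)) w
      rw [dist_comm (f (g w)) w] at hzw
      linarith [hg z, hg w, (hdist (g z) (g w)).2]
    · have hzw := dist_triangle4 (f (g z)) z w (f (g w))
      rw [dist_comm (f (g z)) z] at hzw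
      have hle : dist (f (g z)) (f (g w)) ≤ dist z w + 2 * C := by linarith [hg z, hg w]
      have hmul := mul_le_mul_of_nonneg_left hle hL0.le
      linarith [hlower (g z) (g w)]
  · exact ASDimLe.of_affine_distortion hL0 (by positivity) hlower
      fun a b => by linarith [(hdist a b).2]

/-- Asymptotic dimension is invariant under quasi-isometry: if there is a quasi-isometry
`f : X → Y` between metric spaces, then `asdim X = asdim Y`. -/
theorem asdim_eq_of_quasiIsometry {X Y : Type*} [MetricSpace X] [MetricSpace Y]
    (h : ∃ f : X → Y, IsQuasiIsometry f) :
    asdim X = asdim Y := by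
  obtain ⟨f, hf⟩ := h
  simp only [asdim, hf.asdimLe_iff]
end

section
/- Hurewicz mapping theorem for asymptotic Assouad-Nagata dimension: let f: X → Y be an asymptotically Lipschitz map between metric spaces. Then asdimAN(X) ≤ asdimAN(f) + asdimAN(Y). -/
open Metric Set

/-- The asymptotic Assouad–Nagata dimension of a map `f : X → Z`, as an element of `ℕ∞`:
the least `n` such that some `D(s, K) = a s + b K + c` with `a, b, c > 0` is an
`n`-dimensional control function for `f`, or `∞` if none exists. -/
noncomputable def asdimANMap {X Z : Type*} [MetricSpace X] [MetricSpace Z] (f : X → Z) : ℕ∞ :=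
  sInf {c : ℕ∞ | ∃ n : ℕ, c = (n : ℕ∞) ∧ ∃ a > (0 : ℝ), ∃ b > (0 : ℝ), ∃ c' > (0 : ℝ),
    IsMapControlFunction f n (fun s K => a * s + b * K + c')}

/-- `x` and `y` are joined by a chain in `E` with consecutive distances `< r`. -/
def ChainRel {X : Type*} [MetricSpace X] (E : Set X) (r : ℝ) : X → X → Prop :=
  Relation.ReflTransGen fun x y => x ∈ E ∧ y ∈ E ∧ dist x y < r

/-- The `r`-components of `E` have diameter at most `D`. -/
def ScaleBounded {X : Type*} [MetricSpace X] (E : Set X) (r D : ℝ) : Prop :=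
  ∀ x y, ChainRel E r x y → dist x y ≤ D

section Chains

variable {X : Type*} [MetricSpace X] {E F : Set X} {r s D M L : ℝ} {x y z : X}

theorem ChainRel.symm (h : ChainRel E r x y) : ChainRel E r y x := by
  induction h with
  | refl => exact .refl
  | tail _ h ih => exact .head ⟨h.2.1, h.1, by rw [dist_comm]; exact h.2.2⟩ ih

theorem ChainRel.single (hx : x ∈ E) (hy : y ∈ E) (h : dist x y < r) : ChainRel E r x y :=
  Relation.ReflTransGen.single ⟨hx, hy, h⟩

theorem ChainRel.mono (hEF : E ⊆ F) (hrs : r ≤ s) (h : ChainRel E r x y) : ChainRel F s x y :=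
  Relation.ReflTransGen.mono (fun _ _ h => ⟨hEF h.1, hEF h.2.1, h.2.2.trans_le hrs⟩) _ _ h

theorem ChainRel.mem (h : ChainRel E r x y) (hx : x ∈ E) : y ∈ E := by
  induction h with
  | refl => exact hx
  | tail _ h _ => exact h.2.1

theorem ChainRel.setOf_eq (h : ChainRel E r x y) :
    {z | ChainRel E r x z} = {z | ChainRel E r y z} := by
  ext z
  exact ⟨fun hz => h.symm.trans hz, fun hz => h.trans hz⟩

theorem ScaleBounded.mono (h : ScaleBounded F s D) (hEF : E ⊆ F) (hrs : r ≤ s) (hD : D ≤ M) :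
    ScaleBounded E r M :=
  fun x y hxy => (h x y (hxy.mono hEF hrs)).trans hD

theorem scaleBounded_of_eq_empty (hE : E = ∅) (hD : 0 ≤ D) : ScaleBounded E r D := by
  intro x y h
  induction h with
  | refl => simpa using hD
  | tail _ h _ => simp [hE] at h

/-- If the components of `E` at scale `r` are small compared with the scale `s` at which the
components of `F` are bounded, then the components of `E ∪ F` at scale `r` are bounded. -/
theorem ScaleBounded.union (hE : ScaleBounded E r M) (hF : ScaleBounded F s L)
    (hr : 0 ≤ r) (hM : 0 ≤ M) (hL : 0 ≤ L) (hs : M + 2 * r ≤ s) :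
    ScaleBounded (E ∪ F) r (L + 2 * M + 2 * r) := by
  have key : ∀ x ∈ F, ∀ y, ChainRel (E ∪ F) r x y → (y ∈ F ∧ ChainRel F s x y) ∨
      ∃ z ∈ F, ∃ y' ∈ E, ChainRel F s x z ∧ dist z y' < r ∧ ChainRel E r y' y := by
    intro x hx y h
    induction h with
    | refl => exact Or.inl ⟨hx, .refl⟩
    | @tail y w _ hyw ih =>
      obtain ⟨-, hw, hd⟩ := hyw
      rcases ih with ⟨hy, hxy⟩ | ⟨z, hz, y', hy', hxz, hzy', hy'y⟩
      · rcases hw with hw | hw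
        · exact Or.inr ⟨y, hy, w, hw, hxy, hd, .refl⟩
        · exact Or.inl ⟨hw, hxy.trans (ChainRel.single hy hw (by linarith))⟩
      · rcases hw with hw | hw
        · exact Or.inr ⟨z, hz, y', hy', hxz, hzy', hy'y.trans (ChainRel.single (hy'y.mem hy') hw hd)⟩
        · refine Or.inl ⟨hw, hxz.trans (ChainRel.single hz hw ?_)⟩
          have h1 := hE _ _ hy'y
          have h2 := dist_triangle4 z y' y w
          linarith
  have bound : ∀ x ∈ F, ∀ y, ChainRel (E ∪ F) r x y → dist x y ≤ L + M + r := by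
    intro x hx y h
    rcases key x hx y h with ⟨-, h⟩ | ⟨z, -, y', -, hxz, hzy', hy'y⟩
    · have := hF _ _ h
      linarith
    · have h1 := hE _ _ hy'y
      have h2 := hF _ _ hxz
      have h3 := dist_triangle4 x z y' y
      linarith
  have start : ∀ x ∈ E, ∀ y, ChainRel (E ∪ F) r x y → ChainRel E r x y ∨
      ∃ x', ∃ z ∈ F, ChainRel E r x x' ∧ dist x' z < r ∧ ChainRel (E ∪ F) r z y := by
    intro x hx y h
    induction h with
    | refl => exact Or.inl .refl
    | @tail y w _ hyw ih =>
      rcases ih with h | ⟨x', z, hz, hxx', hd, hzy⟩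
      · rcases hyw.2.1 with hw | hw
        · exact Or.inl (h.trans (ChainRel.single (h.mem hx) hw hyw.2.2))
        · exact Or.inr ⟨y, w, hw, h, hyw.2.2, .refl⟩
      · exact Or.inr ⟨x', z, hz, hxx', hd, hzy.tail hyw⟩
  intro x y h
  by_cases hxF : x ∈ F
  · have := bound x hxF y h
    linarith
  by_cases hxE : x ∈ E
  · rcases start x hxE y h with h | ⟨x', z, hz, hxx', hd, hzy⟩
    · have := hE _ _ h
      linarith
    · have h1 := hE _ _ hxx'
      have h2 := bound z hz y hzy
      have h3 := dist_triangle4 x x' z y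
      linarith
  · rcases Relation.ReflTransGen.cases_head h with rfl | ⟨w, hw, -⟩
    · rw [dist_self]
      positivity
    · exact absurd hw.1 (by simp [hxE, hxF])

end Chains

/-- The bound obtained by gluing `j` layers with linear control of slope `α`. -/
def glueBound (α : ℝ) : ℕ → ℝ
  | 0 => 0
  | j + 1 => (α * (glueBound α j + 2) + 1) + 2 * glueBound α j + 2

theorem glueBound_nonneg {α : ℝ} (hα : 0 ≤ α) (j : ℕ) : 0 ≤ glueBound α j := by
  induction j with
  | zero => exact le_rfl
  | succ j ih =>
    rw [glueBound]
    positivity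

theorem scaleBounded_layers {X : Type*} [MetricSpace X] {α u : ℝ} (hα : 0 ≤ α) (hu : 0 ≤ u)
    (E : Set X) (lev : X → ℕ)
    (h : ∀ j, ScaleBounded {x ∈ E | lev x = j} ((glueBound α j + 2) * u)
      ((α * (glueBound α j + 2) + 1) * u)) (J : ℕ) :
    ScaleBounded {x ∈ E | lev x < J} u (glueBound α J * u) := by
  induction J with
  | zero => exact scaleBounded_of_eq_empty (by simp) (by simp [glueBound])
  | succ J ih =>
    have hq := glueBound_nonneg hα J
    refine (ih.union (h J) hu (by positivity) (by positivity) (by linarith)).mono ?_ le_rfl ?_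
    · rintro x ⟨hx, hlt⟩
      rcases Nat.lt_succ_iff_lt_or_eq.mp hlt with h | h
      · exact Or.inl ⟨hx, h⟩
      · exact Or.inr ⟨hx, h⟩
    · rw [glueBound]
      linarith

/-- A monotone chain of sets, starting with a nonempty one and ending with a set of at most
`n + 1` elements, has at most `n` jumps. -/
theorem card_jumps_le {β : Type*} (c : ℕ → Set β) (hc : Monotone c) (k n : ℕ)
    (h0 : (c 0).Nonempty) (hfin : (c k).Finite) (hcard : (c k).ncard ≤ n + 1) :
    {i ∈ Finset.range k | c i ≠ c (i + 1)}.card ≤ n := by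
  classical
  have key : ∀ j ≤ k, {i ∈ Finset.range j | c i ≠ c (i + 1)}.card + 1 ≤ (c j).ncard := by
    intro j
    induction j with
    | zero =>
      intro _
      simpa [Nat.one_le_iff_ne_zero, Nat.pos_iff_ne_zero] using
        (Set.ncard_pos (hfin.subset (hc (Nat.zero_le k)))).mpr h0
    | succ j ih =>
      intro hj
      have h1 := ih (by omega)
      have hf : (c (j + 1)).Finite := hfin.subset (hc hj)
      rw [Finset.range_add_one, Finset.filter_insert]
      split_ifs with hne
      · have h2 := Set.ncard_lt_ncard ((hc (Nat.le_add_right j 1)).ssubset_of_ne hne) hf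
        rw [Finset.card_insert_of_notMem (by simp)]
        omega
      · exact h1.trans (Set.ncard_le_ncard (hc (Nat.le_add_right j 1)) hf)
  have := key k le_rfl
  omega

/-- From a cover of `A` of multiplicity at most `n + 1` at scale `(k + 1) r`, one obtains `k`
subsets of `A` with bounded `r`-components such that each point of `A` is missed by at most `n`
of them. -/
theorem exists_scaleBounded_family {X : Type*} [MetricSpace X] {A : Set X} {𝒱 : Set (Set X)}
    {n : ℕ} (k : ℕ) {r D : ℝ} (hr : 0 < r) (hD : 0 ≤ D) (hA : A ⊆ ⋃₀ 𝒱)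
    (hbdd : UnifBounded 𝒱 D) (hmult : MultAtMost 𝒱 ((k + 1) * r) (n + 1)) :
    ∃ G : ℕ → Set X, (∀ x ∈ A, {i | i < k ∧ x ∉ G i}.ncard ≤ n) ∧
      ∀ i < k, ScaleBounded (G i) r (D + k * r) := by
  classical
  let N : X → ℕ → Set (Set X) := fun x i => {V | V ∈ 𝒱 ∧ (V ∩ ball x ((i + 1) * r)).Nonempty}
  have hmono : ∀ x, Monotone (N x) := by
    rintro x i j hij V ⟨hV, hn⟩
    refine ⟨hV, hn.mono (inter_subset_inter_right _ (ball_subset_ball ?_))⟩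
    gcongr
  have hself : ∀ x ∈ A, ∀ i, ∃ V ∈ N x i, x ∈ V := by
    intro x hx i
    obtain ⟨V, hV, hxV⟩ := hA hx
    exact ⟨V, ⟨hV, x, hxV, mem_ball_self (by positivity)⟩, hxV⟩
  have hnear : ∀ x y i, dist x y < r → N x i ⊆ N y (i + 1) := by
    rintro x y i hd V ⟨hV, v, hvV, hv⟩
    refine ⟨hV, v, hvV, ?_⟩
    rw [mem_ball] at hv ⊢
    have := dist_triangle v x y
    push_cast
    linarith
  refine ⟨fun i => {x ∈ A | N x i = N x (i + 1)}, ?_, ?_⟩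
  · intro x hx
    have hset : {i | i < k ∧ x ∉ {x ∈ A | N x i = N x (i + 1)}} =
        ↑{i ∈ Finset.range k | N x i ≠ N x (i + 1)} := by
      ext i
      simp [hx]
    rw [hset, Set.ncard_coe_finset]
    obtain ⟨V, hV, -⟩ := hself x hx 0
    exact card_jumps_le (N x) (hmono x) k n ⟨V, hV⟩ (hmult x).1 (hmult x).2
  · intro i hi x y h
    have hinv : N x i = N y i := by
      induction h with
      | refl => rfl
      | @tail y w _ h ih =>
        obtain ⟨hy, hw, hd⟩ := h
        refine ih.trans (Subset.antisymm ?_ ?_)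
        · exact (hnear y w i hd).trans hw.2.symm.subset
        · exact (hnear w y i (by rwa [dist_comm])).trans hy.2.symm.subset
    rcases Relation.ReflTransGen.cases_head h with rfl | ⟨w, hw, -⟩
    · rw [dist_self]
      positivity
    · obtain ⟨V, hV, hxV⟩ := hself x hw.1.1 i
      obtain ⟨v, hvV, hv⟩ := (hinv ▸ hV : V ∈ N y i).2
      have h1 := hbdd V hV.1 x hxV v hvV
      have h2 := dist_triangle x v y
      rw [mem_ball] at hv
      have h3 : ((i : ℝ) + 1) * r ≤ k * r := by
        gcongr
        exact_mod_cast hi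
      linarith

/-- The components of `k` sets covering the space form a cover of multiplicity at most `k`. -/
theorem exists_cover_of_scaleBounded {X : Type*} [MetricSpace X] (k : ℕ) {r D : ℝ}
    (G : ℕ → Set X) (hcov : ∀ x, ∃ i < k, x ∈ G i)
    (hG : ∀ i < k, ScaleBounded (G i) (2 * r) D) :
    ∃ 𝒱 : Set (Set X), ⋃₀ 𝒱 = Set.univ ∧ UnifBounded 𝒱 D ∧ MultAtMost 𝒱 r k := by
  refine ⟨{S | ∃ i < k, ∃ x ∈ G i, S = {y | ChainRel (G i) (2 * r) x y}}, ?_, ?_, ?_⟩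
  · refine eq_univ_of_forall fun x => ?_
    obtain ⟨i, hi, hx⟩ := hcov x
    exact ⟨_, ⟨i, hi, x, hx, rfl⟩, Relation.ReflTransGen.refl⟩
  · rintro _ ⟨i, hi, x, -, rfl⟩ p hp q hq
    exact hG i hi p q (hp.symm.trans hq)
  · intro x
    set 𝒮 := {A | A ∈ {S | ∃ i < k, ∃ x ∈ G i, S = {y | ChainRel (G i) (2 * r) x y}} ∧
      (A ∩ ball x r).Nonempty} with h𝒮
    have hex : ∀ S : Set X, ∃ i, S ∈ 𝒮 →
        i < k ∧ ∃ x ∈ G i, S = {y | ChainRel (G i) (2 * r) x y} := by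
      intro S
      by_cases hS : S ∈ 𝒮
      · obtain ⟨i, hi⟩ := hS.1
        exact ⟨i, fun _ => hi⟩
      · exact ⟨0, fun h => absurd h hS⟩
    choose idx hidx using hex
    have hmaps : ∀ S ∈ 𝒮, idx S ∈ (↑(Finset.range k) : Set ℕ) := fun S hS => by
      simpa using (hidx S hS).1
    have hinj : Set.InjOn idx 𝒮 := by
      intro S hS T hT hST
      obtain ⟨-, p, hp, hSp⟩ := hidx S hS
      obtain ⟨-, q, hq, hTq⟩ := hidx T hT
      obtain ⟨p', hp'S, hp'⟩ := hS.2
      obtain ⟨q', hq'T, hq'⟩ := hT.2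
      rw [← hST] at hq hTq
      rw [hSp] at hp'S
      rw [hTq] at hq'T
      have hd : dist p' q' < 2 * r := by
        have := dist_triangle_right p' q' x
        rw [mem_ball] at hp' hq'
        linarith
      have hpq : ChainRel (G (idx S)) (2 * r) p q :=
        (hp'S.trans (ChainRel.single (ChainRel.mem hp'S hp) (ChainRel.mem hq'T hq) hd)).trans
          (ChainRel.symm hq'T)
      rw [hSp, hTq, hpq.setOf_eq]
    refine ⟨Set.Finite.of_injOn hmaps hinj (Finset.finite_toSet _), ?_⟩
    calc 𝒮.ncard ≤ (↑(Finset.range k) : Set ℕ).ncard := Set.ncard_le_ncard_of_injOn idx hmaps hinj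
      _ = k := by simp

/-- If a space is `n`-dimensional and a map to it is `m`-dimensional, both with linear control,
then the source is `(m + n)`-dimensional with linear control. -/
theorem asdimANLe_add {X Z : Type*} [MetricSpace X] [MetricSpace Z] (f : X → Z) {m n : ℕ}
    (hf : ∃ a > (0 : ℝ), ∃ b > (0 : ℝ), ∀ p q : X, dist (f p) (f q) ≤ a * dist p q + b)
    (hm : ∃ a > (0 : ℝ), ∃ b > (0 : ℝ), ∃ c > (0 : ℝ),
      IsMapControlFunction f m (fun s K => a * s + b * K + c))
    (hn : ASDimANLe Z n) : ASDimANLe X (m + n) := by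
  obtain ⟨a, ha, b, hb, hab⟩ := hf
  obtain ⟨a₁, ha₁, b₁, hb₁, c₁, hc₁, hmap⟩ := hm
  obtain ⟨a₂, ha₂, b₂, hb₂, hZ⟩ := hn
  obtain ⟨k, hk⟩ : ∃ k, k = m + n + 1 := ⟨_, rfl⟩
  have split : ∀ (l : ℕ) (s : ℝ), 0 < s → ∃ G : ℕ → Set Z,
      (∀ z, {i | i < l ∧ z ∉ G i}.ncard ≤ n) ∧
      ∀ i < l, ScaleBounded (G i) s ((a₂ * ((l + 1) * s) + b₂) + l * s) := by
    intro l s hs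
    obtain ⟨𝒱, hcov, hbdd, hmult⟩ := hZ ((l + 1) * s) (by positivity)
    obtain ⟨G, hG, hG'⟩ := exists_scaleBounded_family (A := univ) l hs (by positivity)
      (hcov.symm ▸ subset_univ univ) hbdd hmult
    exact ⟨G, fun z => hG z (mem_univ z), hG'⟩
  set α : ℝ := a₁ * (k + 1) + k with hα_def
  have hα : 0 ≤ α := by positivity
  have splitFiber : ∀ (K s : ℝ), 0 < K → 0 < s → ∀ S : Set Z,
      (∀ p ∈ S, ∀ q ∈ S, dist p q ≤ K) → ∃ G : ℕ → Set X,
      (∀ x, f x ∈ S → {i | i < k ∧ x ∉ G i}.ncard ≤ m) ∧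
      ∀ i < k, ScaleBounded (G i) s (α * s + (b₁ * K + c₁)) := by
    intro K s hK hs S hS
    obtain ⟨𝒱, hcov, hbdd, hmult⟩ := hmap ((k + 1) * s) (by positivity) K hK (f ⁻¹' S)
      (fun p hp q hq => hS _ hp _ hq)
    obtain ⟨G, hG, hG'⟩ := exists_scaleBounded_family k hs (by positivity) hcov hbdd hmult
    exact ⟨G, hG, fun i hi => (hG' i hi).mono Subset.rfl le_rfl (by rw [hα_def]; linarith)⟩
  have main : ∀ r > 0, ∀ σ K τ K' u : ℝ, σ = a * (2 * r) + b →
      K = (a₂ * ((k + 1) * σ) + b₂) + k * σ → τ = K + 1 →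
      K' = (a₂ * (((n + 1 : ℕ) + 1) * τ) + b₂) + (n + 1 : ℕ) * τ →
      u = 2 * r + (b₁ * K' + c₁) →
      ∃ 𝒱 : Set (Set X), ⋃₀ 𝒱 = Set.univ ∧ UnifBounded 𝒱 (glueBound α (n + 1) * u) ∧
        MultAtMost 𝒱 r k := by
    intro r hr σ K τ K' u hσ_def hK_def hτ_def hK'_def hu_def
    have hσ : 0 < σ := by rw [hσ_def]; positivity
    have hK : 0 < K := by rw [hK_def]; positivity
    have hτ : 0 < τ := by linarith
    have hK' : 0 < K' := by rw [hK'_def]; positivity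
    have hκ : 0 < b₁ * K' + c₁ := by positivity
    have hu : 0 < u := by linarith
    obtain ⟨Y, hYmiss, hY⟩ := split k σ hσ
    obtain ⟨A, hAmiss, hA⟩ := split (n + 1) τ hτ
    rw [← hK_def] at hY
    rw [← hK'_def] at hA
    have hlev : ∀ z, ∃ j < n + 1, z ∈ A j := by
      intro z
      by_contra! hcon
      have : {i | i < n + 1 ∧ z ∉ A i} = ↑(Finset.range (n + 1)) := by
        ext i
        simpa using hcon i
      have h := hAmiss z
      rw [this, Set.ncard_coe_finset, Finset.card_range] at h
      omega
    choose lev hlev hlevA using hlev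
    let comp : ℕ → Z → Set Z := fun j z => {w | ChainRel (A j) τ z w}
    have hfib : ∀ (j : ℕ) (S : Set Z), ∃ G : ℕ → Set X,
        (∀ p ∈ S, ∀ q ∈ S, dist p q ≤ K') →
        (∀ x, f x ∈ S → {i | i < k ∧ x ∉ G i}.ncard ≤ m) ∧
        ∀ i < k, ScaleBounded (G i) ((glueBound α j + 2) * u)
          ((α * (glueBound α j + 2) + 1) * u) := by
      intro j S
      by_cases hS : ∀ p ∈ S, ∀ q ∈ S, dist p q ≤ K'
      · have hq := glueBound_nonneg hα j
        obtain ⟨G, hG, hG'⟩ := splitFiber K' ((glueBound α j + 2) * u) hK' (by positivity) S hS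
        exact ⟨G, fun _ => ⟨hG, fun i hi => (hG' i hi).mono Subset.rfl le_rfl (by linarith)⟩⟩
      · exact ⟨fun _ => ∅, fun h => absurd h hS⟩
    choose G hG using hfib
    have hcomp : ∀ j < n + 1, ∀ z, ∀ p ∈ comp j z, ∀ q ∈ comp j z, dist p q ≤ K' :=
      fun j hj z p hp q hq => hA j hj p q ((ChainRel.symm hp).trans hq)
    let B : ℕ → Set X := fun i => {x | x ∈ G (lev (f x)) (comp (lev (f x)) (f x)) i}
    have hBmiss : ∀ x, {i | i < k ∧ x ∉ B i}.ncard ≤ m := fun x =>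
      (hG _ _ (hcomp _ (hlev (f x)) (f x))).1 x Relation.ReflTransGen.refl
    refine exists_cover_of_scaleBounded k (fun i => {x | f x ∈ Y i ∧ x ∈ B i}) ?_ ?_
    · intro x
      by_contra! hcon
      have hsub : (↑(Finset.range k) : Set ℕ) ⊆
          {i | i < k ∧ f x ∉ Y i} ∪ {i | i < k ∧ x ∉ B i} := by
        intro i hi
        have hi : i < k := by simpa using hi
        by_cases hy : f x ∈ Y i
        · exact Or.inr ⟨hi, fun hB => hcon i hi ⟨hy, hB⟩⟩
        · exact Or.inl ⟨hi, hy⟩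
      have hfin : ({i | i < k ∧ f x ∉ Y i} ∪ {i | i < k ∧ x ∉ B i}).Finite :=
        (Set.finite_lt_nat k).subset (union_subset (fun i h => h.1) fun i h => h.1)
      have h1 := Set.ncard_le_ncard hsub hfin
      have h2 := Set.ncard_union_le {i | i < k ∧ f x ∉ Y i} {i | i < k ∧ x ∉ B i}
      have h3 := hYmiss (f x)
      have h4 := hBmiss x
      rw [Set.ncard_coe_finset, Finset.card_range] at h1
      omega
    · intro i hi x y hxy
      set E : Set X := {p | (f p ∈ Y i ∧ p ∈ B i) ∧ ChainRel (Y i) σ (f x) (f p)} with hE_def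
      have hchain : ChainRel (Y i) σ (f x) (f y) ∧ ChainRel E u x y := by
        induction hxy with
        | refl => exact ⟨.refl, .refl⟩
        | @tail y w _ h ih =>
          obtain ⟨hy, hw, hd⟩ := h
          have hd' : dist (f y) (f w) < σ := by
            have h1 := hab y w
            have h2 := mul_lt_mul_of_pos_left hd ha
            linarith
          have hfw : ChainRel (Y i) σ (f x) (f w) := ih.1.trans (ChainRel.single hy.1 hw.1 hd')
          exact ⟨hfw, ih.2.trans (ChainRel.single ⟨hy, ih.1⟩ ⟨hw, hfw⟩ (by linarith))⟩
      have hlayer : ∀ j, ScaleBounded {p ∈ E | lev (f p) = j} ((glueBound α j + 2) * u)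
          ((α * (glueBound α j + 2) + 1) * u) := by
        intro j
        have hq := glueBound_nonneg hα j
        rcases Set.eq_empty_or_nonempty {p ∈ E | lev (f p) = j} with hemp | ⟨p, hp, hpj⟩
        · exact scaleBounded_of_eq_empty hemp (by positivity)
        have hj : j < n + 1 := hpj ▸ hlev (f p)
        refine ((hG j (comp j (f p)) (hcomp j hj (f p))).2 i hi).mono ?_ le_rfl le_rfl
        rintro q ⟨hq, hqj⟩
        have hpA : f p ∈ A j := hpj ▸ hlevA (f p)
        have hqA : f q ∈ A j := hqj ▸ hlevA (f q)
        have hd : dist (f p) (f q) ≤ K := hY i hi _ _ (hp.2.symm.trans hq.2)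
        have hpq : comp j (f p) = comp j (f q) :=
          (ChainRel.single hpA hqA (by linarith)).setOf_eq
        have hqB : q ∈ G (lev (f q)) (comp (lev (f q)) (f q)) i := hq.1.2
        rw [hqj] at hqB
        rw [hpq]
        exact hqB
      refine scaleBounded_layers hα hu.le E (fun p => lev (f p)) hlayer (n + 1) x y
        (hchain.2.mono ?_ le_rfl)
      exact fun p hp => ⟨hp, hlev (f p)⟩
  have hq : 0 < glueBound α (n + 1) := by
    have := glueBound_nonneg hα n
    rw [glueBound]
    positivity
  refine ⟨glueBound α (n + 1) * (2 + b₁ * ((a₂ * ((n + 1 : ℕ) + 1) + (n + 1 : ℕ)) *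
      ((a₂ * (k + 1) + k) * (2 * a)))), by positivity,
    glueBound α (n + 1) * (b₁ * ((a₂ * ((n + 1 : ℕ) + 1) + (n + 1 : ℕ)) *
      ((a₂ * (k + 1) + k) * b + b₂ + 1) + b₂) + c₁), by positivity, fun r hr => ?_⟩
  obtain ⟨𝒱, hcov, hbdd, hmult⟩ := main r hr _ _ _ _ _ rfl rfl rfl rfl rfl
  refine ⟨𝒱, hcov, fun S hS p hp q hq => (hbdd S hS p hp q hq).trans (le_of_eq ?_), hk ▸ hmult⟩
  ring

/-- Hurewicz mapping theorem for asymptotic Assouad–Nagata dimension: if `f : X → Z` is an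
asymptotically Lipschitz map between metric spaces, then
`asdimAN X ≤ asdimAN f + asdimAN Z`. -/
theorem asdimAN_hurewicz {X Z : Type*} [MetricSpace X] [MetricSpace Z] (f : X → Z)
    (hf : ∃ a > (0 : ℝ), ∃ b > (0 : ℝ), ∀ p q : X, dist (f p) (f q) ≤ a * dist p q + b) :
    asdimAN X ≤ asdimANMap f + asdimAN Z := by
  rcases Set.eq_empty_or_nonempty {c : ℕ∞ | ∃ n : ℕ, c = (n : ℕ∞) ∧ ∃ a > (0 : ℝ), ∃ b > (0 : ℝ),
    ∃ c' > (0 : ℝ), IsMapControlFunction f n (fun s K => a * s + b * K + c')} with hM | hM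
  · rw [asdimANMap, hM, sInf_empty, top_add]
    exact le_top
  rcases Set.eq_empty_or_nonempty {c : ℕ∞ | ∃ n : ℕ, c = (n : ℕ∞) ∧ ASDimANLe Z n} with hN | hN
  · rw [asdimAN, asdimAN, hN, sInf_empty, add_top]
    exact le_top
  obtain ⟨m, hm, hm'⟩ := csInf_mem hM
  obtain ⟨n, hn, hn'⟩ := csInf_mem hN
  rw [asdimANMap, asdimAN, asdimAN, hm, hn]
  exact sInf_le ⟨m + n, by push_cast; rfl, asdimANLe_add f hf hm' hn'⟩
end
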